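/- Suppose gcd(α_x, α_y, α_z) = 1 and α_y is odd. Then the eight half-plane operators X|_{D_x^{g_i}}, Z|_{D_z^{g_i}} (i = 0,1,2,3) make the Chamon model 4 logical qubits; precisely: (i) ω(S_s, X|_{D_x^{g_i}}) = 0 and ω(S_s, Z|_{D_z^{g_i}}) = 0 for every s ∈ A \ D and every i; (ii) ω(X|_{D_x^{g_i}}, Z|_{D_z^{g_j}}) = 1 in ZMod 2 if i = j and = 0 if i ≠ j; (iii) none of the eight operators lies in 𝒮, and their eight cosets modulo 𝒮 are linearly independent over ZMod 2. -/

import Mathlib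

namespace Chamon

/-- Ambient group `A = ZMod (2αx) × ZMod (2αy) × ZMod (2αz)`. -/
abbrev Amb (ax ay az : ℕ) : Type :=
  ZMod (2 * ax) × ZMod (2 * ay) × ZMod (2 * az)

/-- Reduction mod 2 of a coordinate. -/
def par {n : ℕ} (a : ZMod (2 * n)) : ZMod 2 :=
  ZMod.castHom (dvd_mul_right 2 n) (ZMod 2) a

variable (ax ay az : ℕ)

def ex : Amb ax ay az := (1, 0, 0)
def ey : Amb ax ay az := (0, 1, 0)
def ez : Amb ax ay az := (0, 0, 1)

/-- The data-qubit set `D`. -/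
def dataSet : Set (Amb ax ay az) :=
  {a | par a.1 + par a.2.1 + par a.2.2 = 0}

/-- A Pauli operator (modulo phase): a pair of functions `D → ZMod 2`. -/
abbrev Pauli : Type :=
  (↥(dataSet ax ay az) → ZMod 2) × (↥(dataSet ax ay az) → ZMod 2)

/-- The stabilizer generator `S_s`. -/
def stab (s : Amb ax ay az) : Pauli ax ay az :=
  (fun d =>
      (if (d : Amb ax ay az) = s + ex ax ay az then 1 else 0) +
      (if (d : Amb ax ay az) = s - ex ax ay az then 1 else 0) +
      (if (d : Amb ax ay az) = s + ey ax ay az then 1 else 0) +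
      (if (d : Amb ax ay az) = s - ey ax ay az then 1 else 0),
   fun d =>
      (if (d : Amb ax ay az) = s + ez ax ay az then 1 else 0) +
      (if (d : Amb ax ay az) = s - ez ax ay az then 1 else 0) +
      (if (d : Amb ax ay az) = s + ey ax ay az then 1 else 0) +
      (if (d : Amb ax ay az) = s - ey ax ay az then 1 else 0))

/-- The symplectic form `ω(P,Q)`. -/
noncomputable def sympl (P Q : Pauli ax ay az) : ZMod 2 :=
  ∑ᶠ d : ↥(dataSet ax ay az), (P.1 d * Q.2 d + P.2 d * Q.1 d)

/-- `X|_E`: X-part is the indicator of `E`, Z-part is zero. -/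
noncomputable def Xop (E : Set (Amb ax ay az)) : Pauli ax ay az :=
  (fun d => E.indicator (fun _ => (1 : ZMod 2)) (d : Amb ax ay az), fun _ => 0)

/-- `Z|_E`: Z-part is the indicator of `E`, X-part is zero. -/
noncomputable def Zop (E : Set (Amb ax ay az)) : Pauli ax ay az :=
  (fun _ => 0, fun d => E.indicator (fun _ => (1 : ZMod 2)) (d : Amb ax ay az))

/-- The `ZMod 2`-linear span `𝒮` of the stabilizer generators. -/
def stabSpan : Submodule (ZMod 2) (Pauli ax ay az) :=
  Submodule.span (ZMod 2) (stab ax ay az '' (dataSet ax ay az)ᶜ)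

/-- The four generating points `g₀, g₁, g₂, g₃`. -/
def gpt : Fin 4 → Amb ax ay az := ![(0,0,0), (1,1,0), (1,0,1), (0,1,1)]

/-- Half-plane support `D_x^g` (parallel to the `yOz` plane). -/
def Dxg (g : Amb ax ay az) : Set (Amb ax ay az) :=
  {d | ∃ l m : ℤ, d = g + (2*l) • ez ax ay az + (2*m) • ey ax ay az}

/-- Half-plane support `D_z^g` (parallel to the `xOy` plane). -/
def Dzg (g : Amb ax ay az) : Set (Amb ax ay az) :=
  {d | ∃ l m : ℤ, d = g + (2*l) • ex ax ay az + (2*m) • ey ax ay az}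

end Chamon


open Chamon

namespace Chamon

theorem par_add {n : ℕ} (a b : ZMod (2 * n)) : par (a + b) = par a + par b := map_add _ a b

theorem par_sub {n : ℕ} (a b : ZMod (2 * n)) : par (a - b) = par a - par b := map_sub _ a b

theorem par_zero {n : ℕ} : par (0 : ZMod (2 * n)) = 0 := map_zero _

theorem par_one {n : ℕ} : par (1 : ZMod (2 * n)) = 1 := map_one _

theorem par_intCast {n : ℕ} (m : ℤ) : par (m : ZMod (2 * n)) = m := map_intCast _ m

/-- Two coordinates have the same parity iff they differ by an even integer. -/
theorem par_eq_par_iff {n : ℕ} (a b : ZMod (2 * n)) :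
    par a = par b ↔ ∃ m : ℤ, a = b + ((2 * m : ℤ) : ZMod (2 * n)) := by
  constructor
  · intro h
    obtain ⟨k, hk⟩ := ZMod.intCast_surjective (a - b)
    have hk0 : (k : ZMod 2) = 0 := by
      rw [← par_intCast (n := n), hk, par_sub, h, sub_self]
    obtain ⟨m, rfl⟩ := (ZMod.intCast_zmod_eq_zero_iff_dvd k 2).mp hk0
    refine ⟨m, ?_⟩
    push_cast at hk ⊢
    rw [hk]
    abel
  · rintro ⟨m, rfl⟩
    rw [par_add, par_intCast]
    push_cast
    rw [show (2 : ZMod 2) = 0 from rfl, zero_mul, add_zero]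

/-- Exactly half of the residues modulo `2 * n` have a given parity. -/
theorem card_filter_par {n : ℕ} [NeZero (2 * n)] (c : ZMod 2) :
    (Finset.univ.filter fun y : ZMod (2 * n) => par y = c).card = n := by
  have hshift : ∀ c : ZMod 2, (Finset.univ.filter fun y : ZMod (2 * n) => par y = c).card
      = (Finset.univ.filter fun y : ZMod (2 * n) => par y = c + 1).card := by
    intro c
    refine Finset.card_bij (fun y _ => y + 1) ?_ ?_ ?_
    · simp +contextual [par_add, par_one]
    · intro a _ b _ h
      exact add_right_cancel h
    · intro b hb
      refine ⟨b - 1, ?_, by simp⟩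
      simp_all [par_sub, par_one]
  have htotal := Finset.card_eq_sum_card_fiberwise (s := (Finset.univ : Finset (ZMod (2 * n))))
    (t := (Finset.univ : Finset (ZMod 2))) (f := par) (fun _ _ => Finset.mem_coe.2 (Finset.mem_univ _))
  rw [Finset.card_univ, ZMod.card, show (Finset.univ : Finset (ZMod 2)) = {0, 1} from rfl,
    Finset.sum_pair (by decide)] at htotal
  have h0 := hshift 0
  rw [zero_add] at h0
  have hc : c = 0 ∨ c = 1 := by
    revert c
    decide
  rcases hc with rfl | rfl <;> omega

variable {ax ay az : ℕ}

theorem mem_Dxg_iff (g d : Amb ax ay az) :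
    d ∈ Dxg ax ay az g ↔
      d.1 = g.1 ∧ par d.2.1 = par g.2.1 ∧ par d.2.2 = par g.2.2 := by
  rw [par_eq_par_iff, par_eq_par_iff]
  simp only [Dxg, Set.mem_ofPred_eq, ez, ey, Prod.ext_iff]
  simp

theorem mem_Dzg_iff (g d : Amb ax ay az) :
    d ∈ Dzg ax ay az g ↔
      par d.1 = par g.1 ∧ par d.2.1 = par g.2.1 ∧ d.2.2 = g.2.2 := by
  rw [par_eq_par_iff, par_eq_par_iff]
  simp only [Dzg, Set.mem_ofPred_eq, ex, ey, Prod.ext_iff]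
  simp

theorem Dxg_subset_dataSet {g : Amb ax ay az} (hg : g ∈ dataSet ax ay az) :
    Dxg ax ay az g ⊆ dataSet ax ay az := by
  intro d hd
  obtain ⟨h1, h2, h3⟩ := (mem_Dxg_iff g d).mp hd
  rw [dataSet, Set.mem_ofPred_eq] at hg ⊢
  rw [h1, h2, h3, hg]

theorem Dzg_subset_dataSet {g : Amb ax ay az} (hg : g ∈ dataSet ax ay az) :
    Dzg ax ay az g ⊆ dataSet ax ay az := by
  intro d hd
  obtain ⟨h1, h2, h3⟩ := (mem_Dzg_iff g d).mp hd
  rw [dataSet, Set.mem_ofPred_eq] at hg ⊢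
  rw [h1, h2, h3, hg]

theorem gpt_mem_dataSet (i : Fin 4) : gpt ax ay az i ∈ dataSet ax ay az := by
  fin_cases i <;> simp [gpt, dataSet, par_zero, par_one] <;> rfl

/-- Distinct generating points are distinguished by their parities. -/
theorem gpt_parity_injective {i j : Fin 4}
    (h1 : par (gpt ax ay az i).1 = par (gpt ax ay az j).1)
    (h2 : par (gpt ax ay az i).2.1 = par (gpt ax ay az j).2.1)
    (h3 : par (gpt ax ay az i).2.2 = par (gpt ax ay az j).2.2) : i = j := by
  fin_cases i <;> fin_cases j <;> simp_all [gpt, par_zero, par_one]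

theorem finsum_dataSet_ite_mul_indicator {E : Set (Amb ax ay az)}
    (hE : E ⊆ dataSet ax ay az) (p : Amb ax ay az) :
    ∑ᶠ d : ↥(dataSet ax ay az),
      (if (d : Amb ax ay az) = p then (1 : ZMod 2) else 0) *
        E.indicator (fun _ => (1 : ZMod 2)) (d : Amb ax ay az) =
      E.indicator (fun _ => (1 : ZMod 2)) p := by
  by_cases hp : p ∈ dataSet ax ay az
  · rw [finsum_eq_single _ (⟨p, hp⟩ : ↥(dataSet ax ay az))]
    · simp
    · intro d hd
      rw [if_neg fun h => hd (Subtype.ext h), zero_mul]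
  · rw [Set.indicator_of_notMem fun h => hp (hE h)]
    refine finsum_eq_zero_of_forall_eq_zero fun d => ?_
    rw [if_neg fun h : (d : Amb ax ay az) = p => hp (h ▸ d.2), zero_mul]

section Finite

variable [NeZero (2 * ax)] [NeZero (2 * ay)] [NeZero (2 * az)]

/-- Pairing with a fixed Pauli operator, as a linear map. -/
noncomputable def symplLinear (Q : Pauli ax ay az) : Pauli ax ay az →ₗ[ZMod 2] ZMod 2 where
  toFun P := sympl ax ay az P Q
  map_add' P P' := by
    rw [sympl, sympl, sympl, ← finsum_add_distrib (Set.toFinite _) (Set.toFinite _)]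
    refine finsum_congr fun d => ?_
    simp only [Prod.fst_add, Prod.snd_add, Pi.add_apply]
    ring
  map_smul' c P := by
    rw [sympl, sympl, RingHom.id_apply, smul_finsum]
    refine finsum_congr fun d => ?_
    simp only [Prod.smul_fst, Prod.smul_snd, Pi.smul_apply, smul_eq_mul]
    ring

/-- A sum of four point masses pairs to zero with a set containing the points in pairs. -/
theorem finsum_dataSet_four_mul_indicator {E : Set (Amb ax ay az)}
    (hE : E ⊆ dataSet ax ay az) {p q u v : Amb ax ay az}
    (hpq : p ∈ E ↔ q ∈ E) (huv : u ∈ E ↔ v ∈ E) :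
    ∑ᶠ d : ↥(dataSet ax ay az),
      ((if (d : Amb ax ay az) = p then (1 : ZMod 2) else 0) +
        (if (d : Amb ax ay az) = q then 1 else 0) +
        (if (d : Amb ax ay az) = u then 1 else 0) +
        (if (d : Amb ax ay az) = v then 1 else 0)) *
        E.indicator (fun _ => (1 : ZMod 2)) (d : Amb ax ay az) = 0 := by
  have h1 : E.indicator (fun _ => (1 : ZMod 2)) p = E.indicator (fun _ => (1 : ZMod 2)) q := by
    classical simp only [Set.indicator_apply, hpq]
  have h2 : E.indicator (fun _ => (1 : ZMod 2)) u = E.indicator (fun _ => (1 : ZMod 2)) v := by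
    classical simp only [Set.indicator_apply, huv]
  simp only [add_mul]
  rw [finsum_add_distrib (Set.toFinite _) (Set.toFinite _),
    finsum_add_distrib (Set.toFinite _) (Set.toFinite _),
    finsum_add_distrib (Set.toFinite _) (Set.toFinite _)]
  simp only [finsum_dataSet_ite_mul_indicator hE]
  rw [h1, h2, CharTwo.add_self_eq_zero, zero_add, CharTwo.add_self_eq_zero]

theorem sympl_stab_Xop {g : Amb ax ay az} (hg : g ∈ dataSet ax ay az) (s : Amb ax ay az) :
    sympl ax ay az (stab ax ay az s) (Xop ax ay az (Dxg ax ay az g)) = 0 := by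
  simp only [sympl, stab, Xop, mul_zero, zero_add]
  apply finsum_dataSet_four_mul_indicator (Dxg_subset_dataSet hg) <;>
    simp [mem_Dxg_iff, ez, ey, par_add, par_sub, par_one, CharTwo.sub_eq_add]

theorem sympl_stab_Zop {g : Amb ax ay az} (hg : g ∈ dataSet ax ay az) (s : Amb ax ay az) :
    sympl ax ay az (stab ax ay az s) (Zop ax ay az (Dzg ax ay az g)) = 0 := by
  simp only [sympl, stab, Zop, mul_zero, add_zero]
  apply finsum_dataSet_four_mul_indicator (Dzg_subset_dataSet hg) <;>
    simp [mem_Dzg_iff, ex, ey, par_add, par_sub, par_one, CharTwo.sub_eq_add]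

theorem finsum_indicator_mul_indicator_self {g : Amb ax ay az} (hg : g ∈ dataSet ax ay az) :
    ∑ᶠ d : ↥(dataSet ax ay az),
      (Dxg ax ay az g).indicator (fun _ => (1 : ZMod 2)) (d : Amb ax ay az) *
        (Dzg ax ay az g).indicator (fun _ => (1 : ZMod 2)) (d : Amb ax ay az) = (ay : ZMod 2) := by
  classical
  rw [finsum_eq_sum_of_fintype]
  simp only [Set.indicator_apply, ← ite_and, ite_mul, one_mul, zero_mul]
  rw [Finset.sum_boole]
  congr 1
  refine Eq.trans ?_ (card_filter_par (n := ay) (par g.2.1))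
  refine Finset.card_bij (fun d _ => (d : Amb ax ay az).2.1) ?_ ?_ ?_
  · intro d hd
    simp only [Finset.mem_filter, Finset.mem_univ, true_and, mem_Dxg_iff] at hd ⊢
    exact hd.1.2.1
  · intro d hd e he h
    simp only [Finset.mem_filter, Finset.mem_univ, true_and, mem_Dxg_iff, mem_Dzg_iff] at hd he
    exact Subtype.ext (Prod.ext (hd.1.1.trans he.1.1.symm)
      (Prod.ext h (hd.2.2.2.trans he.2.2.2.symm)))
  · intro y hy
    simp only [Finset.mem_filter, Finset.mem_univ, true_and] at hy
    have hmem : ((g.1, y, g.2.2) : Amb ax ay az) ∈ Dxg ax ay az g := by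
      simp [mem_Dxg_iff, hy]
    exact ⟨⟨(g.1, y, g.2.2), Dxg_subset_dataSet hg hmem⟩, by simp [mem_Dxg_iff, mem_Dzg_iff, hy], rfl⟩

theorem sympl_Xop_Zop (hodd : Odd ay) (i j : Fin 4) :
    sympl ax ay az (Xop ax ay az (Dxg ax ay az (gpt ax ay az i)))
      (Zop ax ay az (Dzg ax ay az (gpt ax ay az j))) = if i = j then 1 else 0 := by
  simp only [sympl, Xop, Zop, mul_zero, add_zero]
  split_ifs with hij
  · subst hij
    rw [finsum_indicator_mul_indicator_self (gpt_mem_dataSet i)]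
    exact ZMod.natCast_eq_one_iff_odd.mpr hodd
  · refine finsum_eq_zero_of_forall_eq_zero fun d => ?_
    by_cases hx : (d : Amb ax ay az) ∈ Dxg ax ay az (gpt ax ay az i)
    · by_cases hz : (d : Amb ax ay az) ∈ Dzg ax ay az (gpt ax ay az j)
      · rw [mem_Dxg_iff] at hx
        rw [mem_Dzg_iff] at hz
        exact absurd (gpt_parity_injective (hx.1 ▸ hz.1) (hx.2.1.symm.trans hz.2.1)
          (hx.2.2.symm.trans (congrArg par hz.2.2))) hij
      · rw [Set.indicator_of_notMem hz, mul_zero]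
    · rw [Set.indicator_of_notMem hx, zero_mul]

end Finite

theorem sympl_comm (P Q : Pauli ax ay az) : sympl ax ay az P Q = sympl ax ay az Q P :=
  finsum_congr fun d => by ring

theorem sympl_Xop_Xop (E F : Set (Amb ax ay az)) :
    sympl ax ay az (Xop ax ay az E) (Xop ax ay az F) = 0 := by
  simp [sympl, Xop]

theorem sympl_Zop_Zop (E F : Set (Amb ax ay az)) :
    sympl ax ay az (Zop ax ay az E) (Zop ax ay az F) = 0 := by
  simp [sympl, Zop]

variable (ax ay az) in
/-- The eight half-plane operators, the `X`-type ones on the left. -/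
noncomputable def logicalOp : Fin 4 ⊕ Fin 4 → Pauli ax ay az :=
  Sum.elim (fun i => Xop ax ay az (Dxg ax ay az (gpt ax ay az i)))
    (fun i => Zop ax ay az (Dzg ax ay az (gpt ax ay az i)))

section Finite

variable [NeZero (2 * ax)] [NeZero (2 * ay)] [NeZero (2 * az)]

theorem stabSpan_le_ker_symplLinear (k : Fin 4 ⊕ Fin 4) :
    stabSpan ax ay az ≤ LinearMap.ker (symplLinear (logicalOp ax ay az k)) := by
  rw [stabSpan, Submodule.span_le]
  rintro _ ⟨s, -, rfl⟩
  rw [SetLike.mem_coe, LinearMap.mem_ker]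
  cases k with
  | inl i => exact sympl_stab_Xop (gpt_mem_dataSet i) s
  | inr i => exact sympl_stab_Zop (gpt_mem_dataSet i) s

theorem sympl_logicalOp_swap (hodd : Odd ay) (k l : Fin 4 ⊕ Fin 4) :
    sympl ax ay az (logicalOp ax ay az k) (logicalOp ax ay az l.swap) =
      if l = k then 1 else 0 := by
  rcases k with i | i <;> rcases l with j | j
  · simpa [logicalOp, eq_comm] using sympl_Xop_Zop (ax := ax) (az := az) hodd i j
  · simpa [logicalOp] using sympl_Xop_Xop _ _
  · simpa [logicalOp] using sympl_Zop_Zop _ _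
  · rw [sympl_comm]
    simpa [logicalOp] using sympl_Xop_Zop (ax := ax) (az := az) hodd j i

/-- The cosets of the half-plane operators modulo the stabilizer are independent, since the
symplectic form supplies a dual family. -/
theorem linearIndependent_mk_logicalOp (hodd : Odd ay) :
    LinearIndependent (ZMod 2) fun k : Fin 4 ⊕ Fin 4 =>
      Submodule.Quotient.mk (p := stabSpan ax ay az) (logicalOp ax ay az k) := by
  set φ := LinearMap.pi fun l : Fin 4 ⊕ Fin 4 =>
    (stabSpan ax ay az).liftQ _ (stabSpan_le_ker_symplLinear l.swap)
  have hφ (k : Fin 4 ⊕ Fin 4) :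
      φ (Submodule.Quotient.mk (logicalOp ax ay az k)) = Pi.single k (1 : ZMod 2) := by
    ext l
    rw [Pi.single_apply]
    exact sympl_logicalOp_swap hodd k l
  refine LinearIndependent.of_comp φ ?_
  simp only [Function.comp_def, hφ]
  exact Pi.linearIndependent_single_one (Fin 4 ⊕ Fin 4) (ZMod 2)

end Finite

end Chamon

/-- when `gcd(αx,αy,αz) = 1` and `αy` is odd, the eight half-plane
operators `X|_{D_x^{g_i}}, Z|_{D_z^{g_i}}` make the Chamon model 4 logical qubits. -/
theorem chamon_four_logical_qubits (ax ay az : ℕ)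
    (hax : 2 ≤ ax) (hay : 2 ≤ ay) (haz : 2 ≤ az)
    (hgcd : Nat.gcd (Nat.gcd ax ay) az = 1) (hodd : Odd ay) :
    (∀ s ∉ dataSet ax ay az, ∀ i : Fin 4,
        sympl ax ay az (stab ax ay az s) (Xop ax ay az (Dxg ax ay az (gpt ax ay az i))) = 0 ∧
        sympl ax ay az (stab ax ay az s) (Zop ax ay az (Dzg ax ay az (gpt ax ay az i))) = 0) ∧
    (∀ i j : Fin 4,
        sympl ax ay az (Xop ax ay az (Dxg ax ay az (gpt ax ay az i)))
          (Zop ax ay az (Dzg ax ay az (gpt ax ay az j))) =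
        if i = j then 1 else 0) ∧
    (∀ i : Fin 4,
        Xop ax ay az (Dxg ax ay az (gpt ax ay az i)) ∉ stabSpan ax ay az ∧
        Zop ax ay az (Dzg ax ay az (gpt ax ay az i)) ∉ stabSpan ax ay az) ∧
    LinearIndependent (ZMod 2)
      (fun k : Fin 4 ⊕ Fin 4 =>
        Submodule.Quotient.mk (p := stabSpan ax ay az)
          (Sum.elim
            (fun i => Xop ax ay az (Dxg ax ay az (gpt ax ay az i)))
            (fun i => Zop ax ay az (Dzg ax ay az (gpt ax ay az i))) k)) := by
  have : NeZero (2 * ax) := ⟨by omega⟩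
  have : NeZero (2 * ay) := ⟨by omega⟩
  have : NeZero (2 * az) := ⟨by omega⟩
  have hli := linearIndependent_mk_logicalOp (ax := ax) (az := az) hodd
  have hnot (k : Fin 4 ⊕ Fin 4) : logicalOp ax ay az k ∉ stabSpan ax ay az := fun h =>
    hli.ne_zero k ((Submodule.Quotient.mk_eq_zero _).mpr h)
  exact ⟨fun s _ i => ⟨sympl_stab_Xop (gpt_mem_dataSet i) s, sympl_stab_Zop (gpt_mem_dataSet i) s⟩,
    sympl_Xop_Zop hodd, fun i => ⟨hnot (Sum.inl i), hnot (Sum.inr i)⟩, hli⟩
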